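/- For every ε with 0 < ε ≤ 1, the cubic polynomial z ↦ P(z, ε) has three distinct real roots. -/

import Mathlib

/-- The cubic polynomial `P(z, ε)`. -/
def Pcub (z ε : ℝ) : ℝ :=
  (ε ^ 4 + 16 * ε ^ 2 + 64) * z ^ 3
    + (2 * ε ^ 4 - 20 * ε ^ 3 - 24 * ε ^ 2 + 160 * ε - 64) * z ^ 2
    + (ε ^ 4 - 16 * ε ^ 3 + 84 * ε ^ 2 - 112 * ε + 16) * z
    + ε * (4 * ε ^ 2 - 20 * ε + 16)

theorem continuous_Pcub (ε : ℝ) : Continuous fun z => Pcub z ε := by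
  unfold Pcub
  fun_prop

theorem Pcub_neg_one (ε : ℝ) : Pcub (-1) ε = -(144 * (1 - ε) ^ 2) := by
  unfold Pcub
  ring

theorem Pcub_zero (ε : ℝ) : Pcub 0 ε = 4 * (ε * (1 - ε) * (4 - ε)) := by
  unfold Pcub
  ring

theorem Pcub_one_pos {ε : ℝ} (hε0 : 0 < ε) (hε1 : ε ≤ 1) : 0 < Pcub 1 ε := by
  have h : Pcub 1 ε = 16 + 64 * ε + 24 * ε ^ 2 + 32 * (ε ^ 2 * (1 - ε)) + 4 * ε ^ 4 := by
    unfold Pcub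
    ring
  have : 0 ≤ 1 - ε := sub_nonneg.2 hε1
  rw [h]
  positivity

/-- The [1/1] Padé approximant `(4 - ε) / (8 + 10 ε)` of the two upper roots, which merge at `1/2`
as `ε → 0`, lies strictly between them. -/
theorem Pcub_pade_neg {ε : ℝ} (hε0 : 0 < ε) (hε1 : ε ≤ 1) :
    Pcub ((4 - ε) / (8 + 10 * ε)) ε < 0 := by
  have h : Pcub ((4 - ε) / (8 + 10 * ε)) ε
      = -(81 * ε ^ 5 * (256 - 68 * ε + ε ^ 2) / (8 + 10 * ε) ^ 3) := by
    unfold Pcub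
    field_simp
    ring
  have : 0 < 256 - 68 * ε + ε ^ 2 := by nlinarith
  rw [h, neg_lt_zero]
  positivity

/-- For every `0 < ε ≤ 1` the cubic `z ↦ P(z, ε)` has three distinct real roots. -/
theorem Pcub_three_distinct_roots (ε : ℝ) (hε0 : 0 < ε) (hε1 : ε ≤ 1) :
    ∃ z₁ z₂ z₃ : ℝ, z₁ < z₂ ∧ z₂ < z₃ ∧
      Pcub z₁ ε = 0 ∧ Pcub z₂ ε = 0 ∧ Pcub z₃ ε = 0 := by
  rcases hε1.eq_or_lt with rfl | hlt
  · refine ⟨-1, 0, 1 / 3, ?_⟩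
    norm_num [Pcub]
  have hsub : 0 < 1 - ε := sub_pos.2 hlt
  have h4 : 0 < 4 - ε := by linarith
  have hneg : Pcub (-1) ε < 0 := by
    rw [Pcub_neg_one, neg_lt_zero]
    positivity
  have hzero : 0 < Pcub 0 ε := by
    rw [Pcub_zero]
    positivity
  have hpade := Pcub_pade_neg hε0 hε1
  have hone := Pcub_one_pos hε0 hε1
  have hm0 : 0 ≤ (4 - ε) / (8 + 10 * ε) := by positivity
  have hm1 : (4 - ε) / (8 + 10 * ε) ≤ 1 := by
    rw [div_le_one (by positivity)]
    linarith
  obtain ⟨z₁, hz₁, h₁⟩ :=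
    intermediate_value_Ioo (by norm_num) (continuous_Pcub ε).continuousOn ⟨hneg, hzero⟩
  obtain ⟨z₂, hz₂, h₂⟩ :=
    intermediate_value_Ioo' hm0 (continuous_Pcub ε).continuousOn ⟨hpade, hzero⟩
  obtain ⟨z₃, hz₃, h₃⟩ :=
    intermediate_value_Ioo hm1 (continuous_Pcub ε).continuousOn ⟨hpade, hone⟩
  exact ⟨z₁, z₂, z₃, hz₁.2.trans hz₂.1, hz₂.2.trans hz₃.1, h₁, h₂, h₃⟩
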